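/- arXiv:2310.05353 — 3 statements merged into one kernel-verified Lean document; each statement's English description precedes it below -/
import Mathlib

section
/- Let r ≥ 2 and n ≥ 1 be integers. If H ⊆ {1,...,r,⋆}^{[n]} is a nonempty partial class, then C(H) ≤ binom(n, ≤ log_{r/(r-1)} s(H)). -/
/-- A set `S ⊆ [n]` is shattered by a partial class `H ⊆ {1,…,r,⋆}^[n]`
(`⋆` is encoded as `none`) if the restriction of `H` to `S` contains every
total function `S → {1,…,r}`. -/
def IsShattered (n r : ℕ) (H : Set (Fin n → Option (Fin r))) (S : Finset (Fin n)) : Prop :=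
  ∀ g : Fin n → Fin r, ∃ h ∈ H, ∀ i ∈ S, h i = some (g i)

/-- The shattering strength `s(H)`: the number of subsets of `[n]` shattered by `H`. -/
noncomputable def shatterStrength (n r : ℕ) (H : Set (Fin n → Option (Fin r))) : ℕ :=
  {S : Finset (Fin n) | IsShattered n r H S}.ncard

/-- A total class `F` is a net of the partial class `H` if for every `h ∈ H`
there is `f ∈ F` with `h i ≠ f i` for all `i`. -/
def IsNet {ι α : Type*} (H : Set (ι → Option α)) (F : Finset (ι → α)) : Prop :=
  ∀ h ∈ H, ∃ f ∈ F, ∀ i, h i ≠ some (f i)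

/-- The covering number `C(H)`: the minimum size of a net of `H`. -/
noncomputable def coveringNumber {ι α : Type*} (H : Set (ι → Option α)) : ℕ :=
  sInf {m | ∃ F : Finset (ι → α), IsNet H F ∧ F.card = m}

/-- The members of `H` taking the value `y` at `x`. -/
def fiberClass {n r : ℕ} (H : Set (Fin n → Option (Fin r))) (x : Fin n) (y : Fin r) :
    Set (Fin n → Option (Fin r)) :=
  {h ∈ H | h x = some y}

theorem IsShattered.mono {n r : ℕ} {H K : Set (Fin n → Option (Fin r))} (hHK : H ⊆ K)
    {S : Finset (Fin n)} (hS : IsShattered n r H S) : IsShattered n r K S := fun g =>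
  let ⟨h, hh, hg⟩ := hS g
  ⟨h, hHK hh, hg⟩

theorem shatterStrength_pos {n r : ℕ} {H : Set (Fin n → Option (Fin r))} (hH : H.Nonempty) :
    0 < shatterStrength n r H := by
  obtain ⟨h, hh⟩ := hH
  exact (Set.ncard_pos (Set.toFinite _)).2 ⟨∅, fun _ => ⟨h, hh, by simp⟩⟩

theorem IsShattered.notMem_of_fiberClass {n r : ℕ} (hr : 2 ≤ r)
    {H : Set (Fin n → Option (Fin r))} {x : Fin n} {y : Fin r} {S : Finset (Fin n)}
    (hS : IsShattered n r (fiberClass H x y) S) : x ∉ S := by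
  intro hx
  have : Nontrivial (Fin r) := Fin.nontrivial_iff_two_le.2 hr
  obtain ⟨z, hz⟩ := exists_ne y
  obtain ⟨h, hh, hg⟩ := hS fun _ => z
  exact hz (Option.some_injective _ ((hg x hx).symm.trans hh.2))

theorem isShattered_insert_of_forall_fiberClass {n r : ℕ}
    {H : Set (Fin n → Option (Fin r))} {x : Fin n} {S : Finset (Fin n)}
    (hS : ∀ y, IsShattered n r (fiberClass H x y) S) : IsShattered n r H (insert x S) := by
  intro g
  obtain ⟨h, hh, hg⟩ := hS (g x) g
  refine ⟨h, hh.1, fun i hi => ?_⟩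
  rcases Finset.mem_insert.1 hi with rfl | hi
  · exact hh.2
  · exact hg i hi

open Classical in
theorem sum_shatterStrength_fiberClass_le {n r : ℕ} (hr : 2 ≤ r)
    (H : Set (Fin n → Option (Fin r))) (x : Fin n) :
    ∑ y, shatterStrength n r (fiberClass H x y) ≤ (r - 1) * shatterStrength n r H := by
  have hcard (K : Set (Fin n → Option (Fin r))) :
      shatterStrength n r K = (Finset.univ.filter (IsShattered n r K)).card := by
    rw [shatterStrength, ← Set.ncard_coe_finset]
    simp
  simp only [hcard]
  set A := Finset.univ.filter (IsShattered n r H) with hA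
  set B : Fin r → Finset (Finset (Fin n)) :=
    fun y => Finset.univ.filter (IsShattered n r (fiberClass H x y)) with hB
  set A₀ := A.filter (x ∉ ·) with hA₀
  set I := A₀.filter (fun S => ∀ y, S ∈ B y) with hI
  have hBA (y : Fin r) : B y ⊆ A₀ := by
    intro S hS
    have hS' : IsShattered n r (fiberClass H x y) S := by simpa [hB] using hS
    simp only [hA₀, hA, Finset.mem_filter, Finset.mem_univ, true_and]
    exact ⟨hS'.mono fun _ h => h.1, hS'.notMem_of_fiberClass hr⟩
  have hinsert : I.card ≤ (A.filter (¬ x ∉ ·)).card := by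
    refine Finset.card_le_card_of_injOn (insert x) (fun S hS => ?_) (fun S hS T hT hST => ?_)
    · have hS' : ∀ y, IsShattered n r (fiberClass H x y) S := by
        simpa [hB] using (Finset.mem_filter.1 hS).2
      simpa [hA] using isShattered_insert_of_forall_fiberClass hS'
    · have hxS : x ∉ S := (Finset.mem_filter.1 (Finset.mem_filter.1 hS).1).2
      have hxT : x ∉ T := (Finset.mem_filter.1 (Finset.mem_filter.1 hT).1).2
      rw [← Finset.erase_insert hxS, ← Finset.erase_insert hxT, hST]
  have hsplit : A₀.card + (A.filter (¬ x ∉ ·)).card = A.card :=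
    Finset.card_filter_add_card_filter_not _
  have hunion : (A₀ \ I).card ≤ ∑ y, (A₀ \ B y).card := by
    refine (Finset.card_le_card fun S hS => ?_).trans Finset.card_biUnion_le
    simp only [hI, Finset.mem_sdiff, Finset.mem_filter, not_and, not_forall] at hS
    obtain ⟨y, hy⟩ := hS.2 hS.1
    exact Finset.mem_biUnion.2 ⟨y, Finset.mem_univ _, Finset.mem_sdiff.2 ⟨hS.1, hy⟩⟩
  have hI' : (A₀ \ I).card + I.card = A₀.card :=
    Finset.card_sdiff_add_card_eq_card (Finset.filter_subset _ _)
  have hsum : ∑ y, (A₀ \ B y).card + ∑ y, (B y).card = r * A₀.card := by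
    rw [← Finset.sum_add_distrib,
      Finset.sum_congr rfl fun y _ => Finset.card_sdiff_add_card_eq_card (hBA y)]
    simp
  obtain ⟨q, rfl⟩ : ∃ q, r = q + 2 := ⟨r - 2, by omega⟩
  rw [show q + 2 - 1 = q + 1 by omega]
  nlinarith

theorem exists_shatterStrength_fiberClass_le {n r : ℕ} (hr : 2 ≤ r)
    (H : Set (Fin n → Option (Fin r))) (x : Fin n) :
    ∃ y, r * shatterStrength n r (fiberClass H x y) ≤ (r - 1) * shatterStrength n r H := by
  have : Nonempty (Fin r) := ⟨⟨0, by omega⟩⟩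
  by_contra! hlt
  have hsum := Finset.sum_lt_sum_of_nonempty Finset.univ_nonempty
    fun y (_ : y ∈ Finset.univ) => hlt y
  rw [Finset.sum_const, Finset.card_univ, Fintype.card_fin, smul_eq_mul, ← Finset.mul_sum] at hsum
  exact (Nat.lt_of_mul_lt_mul_left hsum).not_ge (sum_shatterStrength_fiberClass_le hr H x)

theorem sum_range_choose_succ (k m : ℕ) :
    ∑ j ∈ Finset.range (m + 1), (k + 1).choose j =
      ∑ j ∈ Finset.range m, k.choose j + ∑ j ∈ Finset.range (m + 1), k.choose j := by
  rw [Finset.sum_range_succ', Finset.sum_range_succ' (fun j => k.choose j)]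
  simp only [Nat.choose_succ_succ, Finset.sum_add_distrib, Nat.choose_zero_right]
  ring

open Classical in
theorem exists_net_on {n r : ℕ} (hr : 2 ≤ r) (T : Finset (Fin n)) :
    ∀ (m : ℕ) (H : Set (Fin n → Option (Fin r))),
      shatterStrength n r H * (r - 1) ^ m < r ^ m →
      ∃ F : Finset (Fin n → Fin r), F.card ≤ ∑ j ∈ Finset.range m, T.card.choose j ∧
        ∀ h ∈ H, ∃ f ∈ F, ∀ i ∈ T, h i ≠ some (f i) := by
  have : Nontrivial (Fin r) := Fin.nontrivial_iff_two_le.2 hr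
  induction T using Finset.induction_on with
  | empty =>
    rintro (_ | m) H hH
    · have hempty : H = ∅ := by
        by_contra hne
        have := shatterStrength_pos (Set.nonempty_iff_ne_empty.2 hne)
        simp at hH
        omega
      exact ⟨∅, by simp, by simp [hempty]⟩
    · refine ⟨{fun _ => ⟨0, by omega⟩}, ?_, by simp⟩
      rw [Finset.sum_range_succ']
      simp
  | insert x T hx ih =>
    rintro (_ | m) H hH
    · obtain ⟨F, hF, hnet⟩ := ih 0 H hH
      have hF' : F = ∅ := by simpa using hF
      subst hF'
      exact ⟨∅, by simp, fun h hh => by simpa using hnet h hh⟩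
    · obtain ⟨y, hy⟩ := exists_shatterStrength_fiberClass_le hr H x
      obtain ⟨z, hz⟩ := exists_ne y
      have hfiber : shatterStrength n r (fiberClass H x y) * (r - 1) ^ m < r ^ m := by
        refine Nat.lt_of_mul_lt_mul_left (a := r) ?_
        calc r * (shatterStrength n r (fiberClass H x y) * (r - 1) ^ m)
            = r * shatterStrength n r (fiberClass H x y) * (r - 1) ^ m := by ring
          _ ≤ (r - 1) * shatterStrength n r H * (r - 1) ^ m := by gcongr
          _ = shatterStrength n r H * (r - 1) ^ (m + 1) := by ring
          _ < r ^ (m + 1) := hH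
          _ = r * r ^ m := by ring
      obtain ⟨F₁, hF₁, hnet₁⟩ := ih m _ hfiber
      obtain ⟨F₀, hF₀, hnet₀⟩ := ih (m + 1) H hH
      refine ⟨F₁.image (Function.update · x z) ∪ F₀.image (Function.update · x y), ?_, ?_⟩
      · rw [Finset.card_insert_of_notMem hx, sum_range_choose_succ]
        exact (Finset.card_union_le _ _).trans
          (add_le_add (Finset.card_image_le.trans hF₁) (Finset.card_image_le.trans hF₀))
      · have hupdate {h : Fin n → Option (Fin r)} {f : Fin n → Fin r} {w : Fin r}
            (hw : h x ≠ some w) (hf : ∀ i ∈ T, h i ≠ some (f i)) :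
            ∀ i ∈ insert x T, h i ≠ some (Function.update f x w i) := by
          intro i hi
          rcases eq_or_ne i x with rfl | hix
          · simpa using hw
          · rw [Function.update_of_ne hix]
            exact hf i (Finset.mem_of_mem_insert_of_ne hi hix)
        intro h hh
        by_cases hxy : h x = some y
        · obtain ⟨f, hf, hfT⟩ := hnet₁ h ⟨hh, hxy⟩
          refine ⟨_, Finset.mem_union_left _ (Finset.mem_image_of_mem _ hf), hupdate ?_ hfT⟩
          rw [hxy]
          exact fun heq => hz (Option.some_injective _ heq).symm
        · obtain ⟨f, hf, hfT⟩ := hnet₀ h hh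
          exact ⟨_, Finset.mem_union_right _ (Finset.mem_image_of_mem _ hf), hupdate hxy hfT⟩

/-- If `H ⊆ {1,…,r,⋆}^[n]` is a nonempty partial class,
then `C(H) ≤ binom(n, ≤ log_{r/(r-1)} s(H))`. -/
theorem stmt1 (r n : ℕ) (hr : 2 ≤ r) (hn : 1 ≤ n)
    (H : Set (Fin n → Option (Fin r))) (hne : H.Nonempty) :
    coveringNumber H ≤
      ∑ j ∈ Finset.range
        (⌊Real.logb ((r : ℝ) / ((r : ℝ) - 1)) (shatterStrength n r H : ℝ)⌋₊ + 1),
        n.choose j := by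
  set s := shatterStrength n r H with hs
  set m := ⌊Real.logb ((r : ℝ) / ((r : ℝ) - 1)) (s : ℝ)⌋₊ + 1 with hm
  have hr' : (2 : ℝ) ≤ r := by exact_mod_cast hr
  have hpos : (0 : ℝ) < (r : ℝ) - 1 := by linarith
  have hbase : 1 < (r : ℝ) / ((r : ℝ) - 1) := by rw [one_lt_div hpos]; linarith
  have hspos : (0 : ℝ) < s := by exact_mod_cast shatterStrength_pos hne
  have hlt : s * (r - 1) ^ m < r ^ m := by
    have hlog : Real.logb ((r : ℝ) / ((r : ℝ) - 1)) (s : ℝ) < (m : ℝ) := by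
      rw [hm]
      exact_mod_cast Nat.lt_floor_add_one _
    rw [Real.logb_lt_iff_lt_rpow hbase hspos, Real.rpow_natCast, div_pow,
      lt_div_iff₀ (pow_pos hpos m)] at hlog
    rw [← Nat.cast_lt (α := ℝ)]
    push_cast [Nat.cast_sub (show 1 ≤ r by omega)]
    exact hlog
  obtain ⟨F, hF, hnet⟩ := exists_net_on hr Finset.univ m H hlt
  rw [Finset.card_univ, Fintype.card_fin] at hF
  refine le_trans (Nat.sInf_le ⟨F, fun h hh => ?_, rfl⟩) hF
  simpa using hnet h hh
end

section
/- Let r ≥ 1 and let X be a nonempty subset of {1,...,r}^{ℕ} that is closed in the product topology and invariant under the shift map T(x)_m = x_{m+1} (that is, T(X) ⊆ X). For n ∈ ℕ define p*_X(n) = max over integers 0 ≤ s_1 < s_2 < ... < s_n of the number of tuples (x_{1+s_1}, x_{1+s_2}, ..., x_{1+s_n}) with x ∈ X. Then there exists ℓ ∈ {1,...,r} such that one of the following holds: (a) ℓ = r and p*_X(n) = r^n for all n ∈ ℕ; (b) ℓ ≤ r-1 and there exists a constant c > 0 such that ℓ^n ≤ p*_X(n) ≤ n^c · ℓ^n for all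 n ≥ 2. -/
/-- The maximal pattern complexity `p*_X(n)` of a set `X ⊆ [r]^ℕ` of sequences:
the maximum, over sets `S` of `n` nonnegative integer positions, of the number of
distinct tuples `(x_i)_{i ∈ S}` with `x ∈ X`. -/
noncomputable def patternComplexity {r : ℕ} (X : Set (ℕ → Fin r)) (n : ℕ) : ℕ :=
  sSup {m | ∃ S : Finset ℕ, S.card = n ∧
    ((fun x : ℕ → Fin r => fun i : S => x (i : ℕ)) '' X).ncard = m}

open Finset in
/-- A finite relation whose fibres have more than `ℓ` elements only over few points is small. -/
theorem card_le_mul_card_image_fst_add {α β : Type*} [Fintype α] [DecidableEq α] [DecidableEq β]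
    (ℓ : ℕ) (W : Finset (β × α)) :
    #W ≤ ℓ * #(W.image Prod.fst) + ∑ A ∈ powersetCard (ℓ + 1) (univ : Finset α),
      Fintype.card α * #{b ∈ W.image Prod.fst | ∀ a ∈ A, (b, a) ∈ W} := by
  have hfib : ∀ b ∈ W.image Prod.fst, #{w ∈ W | w.1 = b} ≤
      ℓ + ∑ A ∈ powersetCard (ℓ + 1) (univ : Finset α),
        if ∀ a ∈ A, (b, a) ∈ W then Fintype.card α else 0 := by
    intro b _
    have hinj : Set.InjOn Prod.snd (↑({w ∈ W | w.1 = b} : Finset (β × α)) : Set (β × α)) := by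
      rintro ⟨x, y⟩ h ⟨x', y'⟩ h' hxy
      simp only [coe_filter, Set.mem_ofPred_eq] at h h' hxy
      rw [h.2, h'.2, hxy]
    have hcard := card_image_of_injOn hinj
    rcases le_or_gt (#{w ∈ W | w.1 = b}) ℓ with hle | hlt
    · exact hle.trans (Nat.le_add_right _ _)
    · obtain ⟨A, hA, hAcard⟩ := exists_subset_card_eq (hcard.symm ▸ hlt : ℓ + 1 ≤ _)
      have hAW : ∀ a ∈ A, (b, a) ∈ W := by
        intro a ha
        obtain ⟨⟨x, y⟩, hw, rfl⟩ := mem_image.1 (hA ha)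
        obtain ⟨hw, hxb⟩ := mem_filter.1 hw
        exact hxb ▸ hw
      calc #{w ∈ W | w.1 = b} ≤ Fintype.card α := hcard ▸ card_le_univ _
        _ = if ∀ a ∈ A, (b, a) ∈ W then Fintype.card α else 0 := (if_pos hAW).symm
        _ ≤ ∑ A ∈ powersetCard (ℓ + 1) (univ : Finset α),
              if ∀ a ∈ A, (b, a) ∈ W then Fintype.card α else 0 :=
            single_le_sum
              (f := fun A : Finset α => if ∀ a ∈ A, (b, a) ∈ W then Fintype.card α else 0)
              (fun _ _ => Nat.zero_le _) (mem_powersetCard.2 ⟨subset_univ _, hAcard⟩)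
        _ ≤ _ := Nat.le_add_left _ _
  calc #W = ∑ b ∈ W.image Prod.fst, #{w ∈ W | w.1 = b} :=
        card_eq_sum_card_fiberwise fun w hw => mem_image_of_mem _ hw
    _ ≤ _ := sum_le_sum hfib
    _ = _ := by
        rw [sum_add_distrib, sum_const, smul_eq_mul, mul_comm, sum_comm]
        congr 1
        refine sum_congr rfl fun A _ => ?_
        rw [← sum_filter, sum_const, smul_eq_mul, mul_comm]

/-- `Y` shatters `T` with width `k` if the restrictions of members of `Y` to `T` include a product
of `k`-element sets. -/
def ShattersWith {ι α : Type*} (k : ℕ) (Y : Set (ι → α)) (T : Finset ι) : Prop :=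
  ∃ A : ι → Finset α, (∀ i ∈ T, (A i).card = k) ∧
    ∀ z : ι → α, (∀ i ∈ T, z i ∈ A i) → ∃ y ∈ Y, ∀ i ∈ T, y i = z i

/-- A set that shatters `T` with width `k` has at least `k ^ #T` restrictions to `T`. -/
theorem ShattersWith.pow_card_le {ι α : Type*} [Finite α] [Nonempty α] {k : ℕ}
    {Y : Set (ι → α)} {T : Finset ι} (h : ShattersWith k Y T) :
    k ^ T.card ≤ (T.restrict '' Y).ncard := by
  classical
  obtain ⟨A, hA, hY⟩ := h
  obtain ⟨a₀⟩ := ‹Nonempty α›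
  have hcard : (Fintype.piFinset fun i : T => A i).card = k ^ T.card := by
    rw [Fintype.card_piFinset, Finset.prod_congr rfl fun (i : T) _ => hA i i.2]
    simp
  rw [← hcard, ← Set.ncard_coe_finset]
  refine Set.ncard_le_ncard ?_ (Set.toFinite _)
  intro w hw
  have hw' : ∀ i : T, w i ∈ A i := Fintype.mem_piFinset.1 hw
  obtain ⟨y, hy, hyw⟩ := hY (fun i => if h : i ∈ T then w ⟨i, h⟩ else a₀) fun i hi => by
    simpa [hi] using hw' ⟨i, hi⟩
  refine ⟨y, hy, funext fun i => ?_⟩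
  simpa using hyw i i.2

/-- The members of `Y` whose value at `a` can be changed to any element of `A` within `Y` without
altering the restriction to `S`. -/
def extendable {ι α : Type*} (Y : Set (ι → α)) (S : Finset ι) (a : ι) (A : Finset α) :
    Set (ι → α) :=
  {x ∈ Y | ∀ v ∈ A, ∃ y ∈ Y, S.restrict y = S.restrict x ∧ y a = v}

theorem ShattersWith.insert_of_extendable {ι α : Type*} [DecidableEq ι] {k : ℕ}
    {Y : Set (ι → α)} {S T : Finset ι} {a : ι} {A : Finset α} (ha : a ∉ S) (hTS : T ⊆ S)
    (hA : A.card = k) (h : ShattersWith k (extendable Y S a A) T) :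
    ShattersWith k Y (insert a T) := by
  obtain ⟨B, hB, hY⟩ := h
  have hne : ∀ i ∈ T, i ≠ a := fun i hi hia => ha (hia ▸ hTS hi)
  refine ⟨Function.update B a A, fun i hi => ?_, fun z hz => ?_⟩
  · rcases Finset.mem_insert.1 hi with rfl | hi
    · simpa using hA
    · simpa [hne i hi] using hB i hi
  · obtain ⟨x, ⟨-, hx⟩, hxz⟩ := hY z fun i hi => by
      simpa [hne i hi] using hz i (Finset.mem_insert_of_mem hi)
    obtain ⟨y, hy, hyx, hya⟩ := hx (z a) (by simpa using hz a (Finset.mem_insert_self a T))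
    refine ⟨y, hy, fun i hi => ?_⟩
    rcases Finset.mem_insert.1 hi with rfl | hi
    · exact hya
    · rw [← hxz i hi]
      exact congrFun hyx ⟨i, hTS hi⟩

theorem ncard_restrict_insert_le {ι α : Type*} [Fintype α] [DecidableEq ι] (ℓ : ℕ)
    (Y : Set (ι → α)) (S : Finset ι) (a : ι) :
    ((insert a S).restrict '' Y).ncard ≤ ℓ * (S.restrict '' Y).ncard +
      ∑ A ∈ Finset.powersetCard (ℓ + 1) (Finset.univ : Finset α),
        Fintype.card α * (S.restrict '' extendable Y S a A).ncard := by
  classical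
  set P : Set ((S → α) × α) := (fun x : ι → α => (S.restrict x, x a)) '' Y with hP
  obtain ⟨W, hW⟩ := (Set.toFinite P).exists_finset_coe
  have hmem : ∀ b v, (b, v) ∈ W ↔ ∃ y ∈ Y, S.restrict y = b ∧ y a = v := by
    intro b v
    rw [← Finset.mem_coe, hW, hP]
    simp [Prod.ext_iff]
  have himage : (insert a S).restrict '' Y = (fun (p : (S → α) × α)
      (i : (insert a S : Finset ι)) => if h : (i : ι) ∈ S then p.1 ⟨i, h⟩ else p.2) '' P := by
    rw [hP, Set.image_image]
    refine Set.image_congr fun x _ => funext fun i => ?_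
    by_cases hi : (i : ι) ∈ S
    · simp [hi]
    · have hia : (i : ι) = a := (Finset.mem_insert.1 i.2).resolve_right hi
      simp [hi, ← hia]
  have hfst : S.restrict '' Y = (W.image Prod.fst : Finset (S → α)) := by
    rw [Finset.coe_image, hW, hP, Set.image_image]
  calc ((insert a S).restrict '' Y).ncard ≤ P.ncard := himage ▸ Set.ncard_image_le
    _ = W.card := by rw [← hW, Set.ncard_coe_finset]
    _ ≤ _ := card_le_mul_card_image_fst_add ℓ W
    _ ≤ _ := by
      rw [hfst, Set.ncard_coe_finset]
      gcongr with A _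
      rw [← Set.ncard_coe_finset]
      refine Set.ncard_le_ncard ?_ (Set.toFinite _)
      intro b hb
      simp only [Finset.coe_filter, Set.mem_ofPred_eq, Finset.mem_image, Prod.exists,
        exists_and_right, exists_eq_right, hmem] at hb
      obtain ⟨⟨v, y, hy, rfl, -⟩, hA⟩ := hb
      exact ⟨y, ⟨hy, hA⟩, rfl⟩

/-- A Sauer–Shelah bound: if `Y` shatters no `m`-element subset of `S` with width `ℓ + 1`, then the
number of restrictions of members of `Y` to `S` exceeds `ℓ ^ #S` by at most a polynomial factor. -/
theorem ncard_restrict_le_of_not_shattersWith {ι α : Type*} [Fintype α] {ℓ : ℕ} (hℓ : 1 ≤ ℓ)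
    (S : Finset ι) (m : ℕ) (Y : Set (ι → α))
    (h : ∀ T ⊆ S, T.card = m → ¬ ShattersWith (ℓ + 1) Y T) :
    (S.restrict '' Y).ncard ≤
      (1 + 2 ^ Fintype.card α * Fintype.card α * S.card) ^ m * ℓ ^ S.card := by
  classical
  set K := 2 ^ Fintype.card α * Fintype.card α with hK
  induction S using Finset.induction_on generalizing m Y with
  | empty => simpa using Set.ncard_le_one_of_subsingleton (Finset.restrict ∅ '' Y)
  | insert a S ha ih =>
    cases m with
    | zero =>
      have hY : Y = ∅ := by
        by_contra hne
        obtain ⟨y, hy⟩ := Set.nonempty_iff_ne_empty.2 hne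
        exact h ∅ (Finset.empty_subset _) rfl ⟨fun _ => ∅, by simp, fun _ _ => ⟨y, hy, by simp⟩⟩
      simp [hY]
    | succ m =>
      have hsame := ih (m + 1) Y fun T hT => h T (hT.trans (Finset.subset_insert a S))
      have hext : ∀ A ∈ Finset.powersetCard (ℓ + 1) (Finset.univ : Finset α),
          Fintype.card α * (S.restrict '' extendable Y S a A).ncard ≤
            Fintype.card α * ((1 + K * S.card) ^ m * ℓ ^ S.card) := by
        intro A hA
        refine Nat.mul_le_mul_left _ (ih m _ fun T hT hTm hsh => ?_)
        refine h (insert a T) (Finset.insert_subset_insert a hT) ?_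
          (hsh.insert_of_extendable ha hT (Finset.mem_powersetCard.1 hA).2)
        rw [Finset.card_insert_of_notMem fun haT => ha (hT haT), hTm]
      have hnum : (Finset.powersetCard (ℓ + 1) (Finset.univ : Finset α)).card ≤
          2 ^ Fintype.card α := by
        rw [Finset.card_powersetCard, Finset.card_univ]
        exact Nat.choose_le_two_pow _ _
      rw [Finset.card_insert_of_notMem ha]
      set n := S.card
      calc ((insert a S).restrict '' Y).ncard
          ≤ _ := ncard_restrict_insert_le ℓ Y S a
        _ ≤ ℓ * ((1 + K * n) ^ (m + 1) * ℓ ^ n) +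
            2 ^ Fintype.card α * (Fintype.card α * ((1 + K * n) ^ m * ℓ ^ n)) := by
          gcongr
          refine (Finset.sum_le_card_nsmul _ _ _ hext).trans ?_
          rw [smul_eq_mul]
          gcongr
        _ = (1 + K * n) ^ m * ((1 + K * n) * ℓ ^ (n + 1) + K * ℓ ^ n) := by rw [hK]; ring
        _ ≤ (1 + K * n) ^ m * ((1 + K * n) * ℓ ^ (n + 1) + K * ℓ ^ (n + 1)) := by
          gcongr
          exact Nat.le_succ n
        _ = (1 + K * n) ^ m * (1 + K * (n + 1)) * ℓ ^ (n + 1) := by ring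
        _ ≤ (1 + K * (n + 1)) ^ m * (1 + K * (n + 1)) * ℓ ^ (n + 1) := by
          gcongr
          exact Nat.le_succ n
        _ = (1 + K * (n + 1)) ^ (m + 1) * ℓ ^ (n + 1) := by ring

theorem ncard_restrict_le_pow {r : ℕ} (X : Set (ℕ → Fin r)) (S : Finset ℕ) :
    (S.restrict '' X).ncard ≤ r ^ S.card := by
  simpa using Set.ncard_le_card (S.restrict '' X)

theorem bddAbove_patternCounts {r : ℕ} (X : Set (ℕ → Fin r)) (n : ℕ) :
    BddAbove {m | ∃ S : Finset ℕ, S.card = n ∧ (S.restrict '' X).ncard = m} := by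
  refine ⟨r ^ n, ?_⟩
  rintro _ ⟨S, rfl, rfl⟩
  exact ncard_restrict_le_pow X S

theorem ncard_restrict_le_patternComplexity {r : ℕ} (X : Set (ℕ → Fin r)) (S : Finset ℕ) :
    (S.restrict '' X).ncard ≤ patternComplexity X S.card :=
  le_csSup (bddAbove_patternCounts X S.card) (Set.mem_ofPred.2 ⟨S, rfl, rfl⟩)

theorem exists_ncard_restrict_eq_patternComplexity {r : ℕ} (X : Set (ℕ → Fin r)) (n : ℕ) :
    ∃ S : Finset ℕ, S.card = n ∧ (S.restrict '' X).ncard = patternComplexity X n :=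
  Nat.sSup_mem (s := {m | ∃ S : Finset ℕ, S.card = n ∧ (S.restrict '' X).ncard = m})
    ⟨_, Finset.range n, Finset.card_range n, rfl⟩ (bddAbove_patternCounts X n)

theorem one_add_mul_pow_le_rpow (K m : ℕ) {n : ℕ} (hn : 2 ≤ n) :
    ((1 + K * n) ^ m : ℝ) ≤ (n : ℝ) ^ (((K + 2) * m + 1 : ℕ) : ℝ) := by
  rw [Real.rpow_natCast]
  have hle : 1 + K * n ≤ n ^ (K + 2) :=
    calc 1 + K * n ≤ (K + 1) * n := by nlinarith
      _ ≤ n ^ (K + 1) * n := by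
        gcongr
        exact (Nat.lt_pow_self (by omega)).le
      _ = n ^ (K + 2) := by ring
  have : (1 + K * n) ^ m ≤ n ^ ((K + 2) * m + 1) :=
    calc (1 + K * n) ^ m ≤ (n ^ (K + 2)) ^ m := by gcongr
      _ = n ^ ((K + 2) * m) := by rw [pow_mul]
      _ ≤ n ^ ((K + 2) * m + 1) := Nat.pow_le_pow_right (by omega) (Nat.le_succ _)
  exact_mod_cast this

/-- **Theorem 3.3.** Let `r ≥ 1` and let `X` be a nonempty subset of `[r]^ℕ`, closed in
the product topology and invariant under the shift `T x = (m ↦ x (m+1))`. Then there is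
`ℓ ∈ {1,…,r}` such that either (a) `ℓ = r` and `p*_X(n) = r^n` for all `n ≥ 1`, or
(b) `ℓ ≤ r - 1` and there is a constant `c > 0` with `ℓ^n ≤ p*_X(n) ≤ n^c·ℓ^n` for all
`n ≥ 2`. -/
theorem stmt13 (r : ℕ) (hr : 1 ≤ r) (X : Set (ℕ → Fin r)) (hne : X.Nonempty)
    (hclosed : IsClosed X) (hinv : ∀ x ∈ X, (fun m => x (m + 1)) ∈ X) :
    ∃ ℓ : ℕ, 1 ≤ ℓ ∧ ℓ ≤ r ∧
      ((ℓ = r ∧ ∀ n : ℕ, 1 ≤ n → patternComplexity X n = r ^ n) ∨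
       (ℓ ≤ r - 1 ∧ ∃ c : ℝ, 0 < c ∧ ∀ n : ℕ, 2 ≤ n →
          ℓ ^ n ≤ patternComplexity X n ∧
          (patternComplexity X n : ℝ) ≤ (n : ℝ) ^ c * (ℓ : ℝ) ^ n)) := by
  classical
  have : Nonempty (Fin r) := ⟨⟨0, hr⟩⟩
  have hone : ∀ n, 1 ^ n ≤ patternComplexity X n := by
    intro n
    have h := ncard_restrict_le_patternComplexity X (Finset.range n)
    rw [Finset.card_range] at h
    rw [one_pow]
    exact ((Set.ncard_pos (Set.toFinite _)).2 (hne.image _)).trans_le h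
  set ℓ := Nat.findGreatest (fun ℓ => ∀ n, ℓ ^ n ≤ patternComplexity X n) r
  have hℓone : 1 ≤ ℓ := Nat.le_findGreatest hr hone
  have hℓr : ℓ ≤ r := Nat.findGreatest_le r
  have hlower : ∀ n, ℓ ^ n ≤ patternComplexity X n :=
    Nat.findGreatest_spec (P := fun ℓ => ∀ n, ℓ ^ n ≤ patternComplexity X n) hr hone
  refine ⟨ℓ, hℓone, hℓr, ?_⟩
  rcases hℓr.eq_or_lt with heq | hlt
  · refine Or.inl ⟨heq, fun n _ => le_antisymm ?_ ((congrArg (· ^ n) heq).ge.trans (hlower n))⟩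
    obtain ⟨S, rfl, hS⟩ := exists_ncard_restrict_eq_patternComplexity X n
    exact hS ▸ ncard_restrict_le_pow X S
  · have hnot : ¬ ∀ n, (ℓ + 1) ^ n ≤ patternComplexity X n :=
      Nat.findGreatest_is_greatest (Nat.lt_succ_self ℓ) hlt
    push Not at hnot
    obtain ⟨m, hm⟩ := hnot
    refine Or.inr ⟨Nat.le_sub_one_of_lt hlt,
      (((2 ^ r * r + 2) * m + 1 : ℕ) : ℝ), by positivity, fun n hn => ⟨hlower n, ?_⟩⟩
    obtain ⟨S, rfl, hS⟩ := exists_ncard_restrict_eq_patternComplexity X n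
    have hupper := ncard_restrict_le_of_not_shattersWith hℓone S m X fun T _ hT hsh =>
      (hT ▸ hm).not_ge (hsh.pow_card_le.trans (ncard_restrict_le_patternComplexity X T))
    rw [hS, Fintype.card_fin] at hupper
    calc (patternComplexity X S.card : ℝ)
        ≤ (1 + (2 ^ r * r : ℕ) * S.card : ℝ) ^ m * (ℓ : ℝ) ^ S.card := by exact_mod_cast hupper
      _ ≤ _ := by
        gcongr
        exact one_add_mul_pow_le_rpow (2 ^ r * r) m hn
end

section
/- Let (X,T) be a topological dynamical system. Suppose U is a finite open cover of X with L(U) = +∞. Then there exists an open cover V = {V_1, V_2} of X of size two with L(V) = +∞. -/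
open Filter Topology
open scoped ENNReal

/-- The minimum cardinality `N(𝒰)` of a subcover chosen from the cover `𝒰` of `X`. -/
noncomputable def coverN {X : Type*} (𝒰 : Set (Set X)) : ℕ :=
  sInf {m | ∃ F : Finset (Set X), ↑F ⊆ 𝒰 ∧ ⋃₀ (F : Set (Set X)) = Set.univ ∧ F.card = m}

/-- The joint `⋁_{i ∈ S} T^{-i} U` of the preimages of the (indexed) open cover `U`
under the iterates of `T`, over a finite set `S ⊆ ℕ ∪ {0}`. -/
def joinCover {X ι : Type*} (T : X → X) (U : ι → Set X) (S : Finset ℕ) : Set (Set X) :=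
  {A | ∃ f : ℕ → ι, A = ⋂ i ∈ S, (T^[i]) ⁻¹' (U (f i))}

/-- `p*_{X,U}(n)`: the maximum of `N(⋁_{i ∈ S} T^{-i} U)` over `n`-element sets
`S ⊆ ℕ ∪ {0}`. -/
noncomputable def pstar {X ι : Type*} (T : X → X) (U : ι → Set X) (n : ℕ) : ℕ :=
  sSup {m | ∃ S : Finset ℕ, S.card = n ∧ coverN (joinCover T U S) = m}

/-- `L(U) = limsup_{n → ∞} (log₂ p*_{X,U}(n)) / (log₂ (n+1))²`, valued in `[0, ∞]`. -/
noncomputable def Lcov {X ι : Type*} (T : X → X) (U : ι → Set X) : ℝ≥0∞ :=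
  Filter.limsup
    (fun n : ℕ => ENNReal.ofReal
      (Real.logb 2 (pstar T U n) / (Real.logb 2 ((n : ℝ) + 1)) ^ 2))
    Filter.atTop

section Covers

variable {X ι : Type*} {T : X → X} {U : ι → Set X}

theorem coverN_le_card {𝒰 : Set (Set X)} {F : Finset (Set X)} (hF : ↑F ⊆ 𝒰)
    (hcover : ⋃₀ (F : Set (Set X)) = Set.univ) : coverN 𝒰 ≤ F.card :=
  Nat.sInf_le ⟨F, hF, hcover, rfl⟩

/-- A finite cover has a joint over `S` with at most `(#ι)^#S` elements. -/
theorem exists_subcover_joinCover [Fintype ι] (T : X → X) (hU : ⋃ i, U i = Set.univ)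
    (S : Finset ℕ) :
    ∃ F : Finset (Set X), ↑F ⊆ joinCover T U S ∧ ⋃₀ (F : Set (Set X)) = Set.univ ∧
      F.card ≤ Fintype.card ι ^ S.card := by
  classical
  rcases isEmpty_or_nonempty X with hX | ⟨⟨x₀⟩⟩
  · exact ⟨∅, by simp, Set.eq_univ_of_forall fun x => (hX.false x).elim, by simp⟩
  have hmem (x : X) : ∃ i, x ∈ U i := Set.mem_iUnion.1 (hU ▸ Set.mem_univ x)
  obtain ⟨i₀, -⟩ := hmem x₀
  choose c hc using hmem
  let extend (f : S → ι) (j : ℕ) : ι := if h : j ∈ S then f ⟨j, h⟩ else i₀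
  refine ⟨Finset.univ.image fun f : S → ι => ⋂ j ∈ S, (T^[j]) ⁻¹' (U (extend f j)),
    ?_, ?_, ?_⟩
  · intro A hA
    obtain ⟨f, -, rfl⟩ := Finset.mem_image.1 (Finset.mem_coe.1 hA)
    exact ⟨extend f, rfl⟩
  · refine Set.eq_univ_of_forall fun x => Set.mem_sUnion.2
      ⟨_, Finset.mem_coe.2 (Finset.mem_image_of_mem _
        (Finset.mem_univ fun j : S => c (T^[j] x))), ?_⟩
    refine Set.mem_iInter₂.2 fun j hj => ?_
    simp only [extend, dif_pos hj]
    exact hc _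
  · refine Finset.card_image_le.trans ?_
    simp

theorem exists_minimal_subcover_joinCover [Fintype ι] (T : X → X) (hU : ⋃ i, U i = Set.univ)
    (S : Finset ℕ) :
    ∃ F : Finset (Set X), ↑F ⊆ joinCover T U S ∧ ⋃₀ (F : Set (Set X)) = Set.univ ∧
      F.card = coverN (joinCover T U S) := by
  obtain ⟨F, hF, hcover, -⟩ := exists_subcover_joinCover T hU S
  exact Nat.sInf_mem (s := {m | ∃ F : Finset (Set X), ↑F ⊆ joinCover T U S ∧
    ⋃₀ (F : Set (Set X)) = Set.univ ∧ F.card = m}) ⟨_, F, hF, hcover, rfl⟩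

theorem coverN_joinCover_pos [Nonempty X] [Fintype ι] (T : X → X) (hU : ⋃ i, U i = Set.univ)
    (S : Finset ℕ) : 0 < coverN (joinCover T U S) := by
  obtain ⟨F, -, hcover, hcard⟩ := exists_minimal_subcover_joinCover T hU S
  rw [← hcard, Finset.card_pos, Finset.nonempty_iff_ne_empty]
  rintro rfl
  simp [Set.empty_ne_univ] at hcover

theorem coverN_joinCover_le_pstar [Fintype ι] (T : X → X) (hU : ⋃ i, U i = Set.univ)
    (S : Finset ℕ) : coverN (joinCover T U S) ≤ pstar T U S.card := by
  refine le_csSup ⟨Fintype.card ι ^ S.card, ?_⟩ ⟨S, rfl, rfl⟩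
  rintro _ ⟨S', hS', rfl⟩
  obtain ⟨F, hF, hcover, hcard⟩ := exists_subcover_joinCover T hU S'
  exact (coverN_le_card hF hcover).trans (hS' ▸ hcard)

theorem pstar_pos [Nonempty X] [Fintype ι] (T : X → X) (hU : ⋃ i, U i = Set.univ) (n : ℕ) :
    0 < pstar T U n := by
  simpa using (coverN_joinCover_pos T hU (Finset.range n)).trans_le
    (coverN_joinCover_le_pstar T hU (Finset.range n))

theorem iUnion_pair_compl_eq_univ {A B : Set X} (h : B ⊆ A) :
    ⋃ k, (![A, Bᶜ] : Fin 2 → Set X) k = Set.univ := by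
  refine Set.eq_univ_of_forall fun x => Set.mem_iUnion.2 ?_
  by_cases hx : x ∈ B
  · exact ⟨0, h hx⟩
  · exact ⟨1, hx⟩

/-- If the sets `C i ⊆ U i` cover `X`, then the joint of the two-element covers
`{U i, (C i)ᶜ}` refines `U`. -/
theorem coverN_joinCover_le_prod [Nonempty X] [Fintype ι] {C : ι → Set X} (T : X → X)
    (hC : ⋃ i, C i = Set.univ) (hCU : ∀ i, C i ⊆ U i) (S : Finset ℕ) :
    coverN (joinCover T U S) ≤ ∏ i, coverN (joinCover T ![U i, (C i)ᶜ] S) := by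
  classical
  have hmem (x : X) : ∃ i, x ∈ C i := Set.mem_iUnion.1 (hC ▸ Set.mem_univ x)
  choose F hF hFcover hFcard using fun i =>
    exists_minimal_subcover_joinCover T (iUnion_pair_compl_eq_univ (hCU i)) S
  have hrefine (A : ι → Set X) (hA : A ∈ Fintype.piFinset F) :
      ∃ B ∈ joinCover T U S, ⋂ i, A i ⊆ B := by
    choose f hf using fun i => hF i (Finset.mem_coe.2 (Fintype.mem_piFinset.1 hA i))
    have hg (j : ℕ) : ∃ k, (∃ i, f i j = 0) → f k j = 0 := by
      by_cases h : ∃ i, f i j = 0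
      · exact ⟨h.choose, fun _ => h.choose_spec⟩
      · exact ⟨(hmem (Classical.arbitrary X)).choose, fun h' => (h h').elim⟩
    choose g hg using hg
    refine ⟨_, ⟨g, rfl⟩, fun x hx => Set.mem_iInter₂.2 fun j hj => ?_⟩
    have hxV (i : ι) : T^[j] x ∈ (![U i, (C i)ᶜ] : Fin 2 → Set X) (f i j) := by
      have hxA := Set.mem_iInter.1 hx i
      rw [hf i] at hxA
      exact Set.mem_iInter₂.1 hxA j hj
    obtain ⟨k, hk⟩ := hmem (T^[j] x)
    have hzero : f k j = 0 := by
      by_contra hne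
      have h := hxV k
      rw [Fin.eq_one_of_ne_zero _ hne] at h
      exact h hk
    have h := hxV (g j)
    rw [hg j ⟨k, hzero⟩] at h
    exact h
  choose! B hB hAB using hrefine
  have hcard : ((Fintype.piFinset F).image B).card ≤ ∏ i, (F i).card :=
    Finset.card_image_le.trans (Fintype.card_piFinset F).le
  simp only [hFcard] at hcard
  refine (coverN_le_card ?_ ?_).trans hcard
  · intro b hb
    obtain ⟨A, hA, rfl⟩ := Finset.mem_image.1 (Finset.mem_coe.1 hb)
    exact hB A hA
  · refine Set.eq_univ_of_forall fun x => ?_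
    choose A hA hxA using fun i => Set.mem_sUnion.1 (hFcover i ▸ Set.mem_univ x)
    have hA' : A ∈ Fintype.piFinset F := Fintype.mem_piFinset.2 hA
    exact Set.mem_sUnion.2 ⟨B A, Finset.mem_coe.2 (Finset.mem_image_of_mem B hA'),
      hAB A hA' (Set.mem_iInter.2 hxA)⟩

theorem pstar_le_prod [Nonempty X] [Fintype ι] {C : ι → Set X} (T : X → X)
    (hC : ⋃ i, C i = Set.univ) (hCU : ∀ i, C i ⊆ U i) (n : ℕ) :
    pstar T U n ≤ ∏ i, pstar T ![U i, (C i)ᶜ] n := by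
  refine csSup_le ⟨_, Finset.range n, Finset.card_range n, rfl⟩ ?_
  rintro _ ⟨S, rfl, rfl⟩
  exact (coverN_joinCover_le_prod T hC hCU S).trans <| Finset.prod_le_prod' fun i _ =>
    coverN_joinCover_le_pstar T (iUnion_pair_compl_eq_univ (hCU i)) S

theorem Lcov_lt_top_of_pair [Nonempty X] [Fintype ι] {C : ι → Set X} (T : X → X)
    (hC : ⋃ i, C i = Set.univ) (hCU : ∀ i, C i ⊆ U i)
    (h : ∀ i, Lcov T ![U i, (C i)ᶜ] < ⊤) : Lcov T U < ⊤ := by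
  have hpos (i : ι) (n : ℕ) : 0 < pstar T ![U i, (C i)ᶜ] n :=
    pstar_pos T (iUnion_pair_compl_eq_univ (hCU i)) n
  have hU : ⋃ i, U i = Set.univ :=
    Set.eq_univ_of_univ_subset (hC.symm.subset.trans (Set.iUnion_mono hCU))
  choose b hLb hb using fun i => exists_between (h i)
  have hev : ∀ᶠ n : ℕ in atTop, ∀ i, ENNReal.ofReal
      (Real.logb 2 (pstar T ![U i, (C i)ᶜ] n) / (Real.logb 2 ((n : ℝ) + 1)) ^ 2) < b i :=
    Filter.eventually_all.2 fun i => Filter.eventually_lt_of_limsup_lt (hLb i)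
  refine lt_of_le_of_lt (Filter.limsup_le_of_le (a := ∑ i, b i) (h := ?_))
    (ENNReal.sum_lt_top.2 fun i _ => hb i)
  filter_upwards [hev] with n hn
  refine le_trans ?_ (Finset.sum_le_sum fun i _ => (hn i).le)
  rw [← ENNReal.ofReal_sum_of_nonneg fun i _ => div_nonneg
    (Real.logb_nonneg one_lt_two (by exact_mod_cast hpos i n)) (sq_nonneg _),
    ← Finset.sum_div]
  refine ENNReal.ofReal_le_ofReal (div_le_div_of_nonneg_right ?_ (sq_nonneg _))
  rw [← Real.logb_prod _ _ fun i _ => by exact_mod_cast (hpos i n).ne']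
  exact Real.logb_le_logb_of_le one_lt_two (by exact_mod_cast pstar_pos T hU n)
    (by exact_mod_cast pstar_le_prod T hC hCU n)

end Covers

/-- **Lemma A.3** (after Blanchard). Let `(X,T)` be a topological dynamical system and
`U` a finite open cover of `X` with `L(U) = +∞`. Then there is an open cover
`V = {V 0, V 1}` of size two with `L(V) = +∞`. -/
theorem stmt17 {X : Type*} [TopologicalSpace X] [CompactSpace X]
    [TopologicalSpace.MetrizableSpace X] [Nonempty X]
    (T : X → X) (hT : Continuous T) (m : ℕ) (U : Fin m → Set X)
    (hopen : ∀ i, IsOpen (U i)) (hcover : ⋃ i, U i = Set.univ)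
    (hL : Lcov T U = ⊤) :
    ∃ V : Fin 2 → Set X, (∀ i, IsOpen (V i)) ∧ (⋃ i, V i) = Set.univ ∧
      Lcov T V = ⊤ := by
  obtain ⟨C, hC, hCclosed, hCU⟩ := exists_iUnion_eq_closed_subset hopen
    (fun _ => Set.toFinite _) hcover
  obtain ⟨i, hi⟩ : ∃ i, Lcov T ![U i, (C i)ᶜ] = ⊤ := by
    by_contra! hne
    exact (Lcov_lt_top_of_pair T hC hCU fun i => (hne i).lt_top).ne hL
  refine ⟨![U i, (C i)ᶜ], ?_, iUnion_pair_compl_eq_univ (hCU i), hi⟩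
  simpa [Fin.forall_fin_two] using ⟨hopen i, hCclosed i⟩
end
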